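/- arXiv:1603.07168 — 5 statements merged into one kernel-verified Lean document; each statement's English description precedes it below -/
import Mathlib

section
/- Let I be a (2,2)-E3-SAT instance and G_I the bipartite graph constructed from I. Then every popular matching M of G_I satisfies: M contains no interconnecting edge; for each variable v_j, the restriction of M to the variable gadget is one of the two perfect matchings {(a_{j1},b_{j1}),(a_{j2},b_{j2})} or {(a_{j1},b_{j2}),(a_{j2},b_{j1})}; and for each clause C_i, exactly one vertex among y_{i1}, y_{i2}, y_{i3} is unmatched in M, and the interconnecting neighbor a_{jt} of this unmatched vertex is matched in M to b_{j1}. -/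
open Classical

noncomputable section

variable {A B : Type*}

/-- A matching in the bipartite graph `G = (A ∪ B, E)`, represented as a partial
function assigning to each applicant `a ∈ A` its partner post (if any). -/
def IsMatching (E : A → B → Prop) (M : A → Option B) : Prop :=
  (∀ a b, M a = some b → E a b) ∧ ∀ a a' b, M a = some b → M a' = some b → a = a'

/-- Post `b` is matched in `M`. -/
def PostMatched (M : A → Option B) (b : B) : Prop := ∃ a, M a = some b

/-- Applicant `a` prefers matching `M` to `M'` (lower rank = more preferred);
an applicant prefers being matched to being unmatched. -/
def APrefers (rank : A → B → ℕ) (M M' : A → Option B) (a : A) : Prop :=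
  match M a, M' a with
  | some _, none => True
  | some b, some b' => rank a b < rank a b'
  | none, _ => False

/-- In the model where each post puts all its neighbors into a single tie,
post `b` prefers `M` to `M'` iff it is matched in `M` and unmatched in `M'`. -/
def BPrefers (M M' : A → Option B) (b : B) : Prop :=
  PostMatched M b ∧ ¬ PostMatched M' b

/-- `phi rank M M'` is the number of vertices preferring `M` to `M'`
(both sides vote; posts have all neighbors in a single tie). -/
def phi (rank : A → B → ℕ) (M M' : A → Option B) : ℕ :=
  Nat.card {a : A // APrefers rank M M' a} + Nat.card {b : B // BPrefers M M' b}

/-- `M` is a popular matching of `G` (two-sided votes, one-sided ties model). -/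
def Popular (E : A → B → Prop) (rank : A → B → ℕ) (M : A → Option B) : Prop :=
  IsMatching E M ∧ ∀ M', IsMatching E M' → phi rank M' M ≤ phi rank M M'

/-- The applicants' preference lists are strict: distinct neighbors get distinct ranks. -/
def StrictRanks (E : A → B → Prop) (rank : A → B → ℕ) : Prop :=
  ∀ a b b', E a b → E a b' → rank a b = rank a b' → b = b'

/-- `f a` is applicant `a`'s top-ranked neighbor. -/
def IsTopChoice (E : A → B → Prop) (rank : A → B → ℕ) (f : A → B) : Prop :=
  ∀ a, E a (f a) ∧ ∀ b, E a b → rank a (f a) ≤ rank a b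

/-- Post `b` (with preference list `prank b`, possibly containing ties) prefers `M`
to `M'`: either matched in `M` and unmatched in `M'`, or matched in both to a
strictly better-ranked partner in `M`. -/
def BPrefersGen (prank : B → A → ℕ) (M M' : A → Option B) (b : B) : Prop :=
  (PostMatched M b ∧ ¬ PostMatched M' b) ∨
    ∃ a a', M a = some b ∧ M' a' = some b ∧ prank b a < prank b a'

/-- Number of vertices preferring `M` to `M'` when posts have general preference lists. -/
def phiGen (rank : A → B → ℕ) (prank : B → A → ℕ) (M M' : A → Option B) : ℕ :=
  Nat.card {a : A // APrefers rank M M' a} +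
    Nat.card {b : B // BPrefersGen prank M M' b}

/-- `M` is a popular matching (two-sided votes; posts have preference lists `prank`). -/
def PopularGen (E : A → B → Prop) (rank : A → B → ℕ) (prank : B → A → ℕ)
    (M : A → Option B) : Prop :=
  IsMatching E M ∧ ∀ M', IsMatching E M' →
    phiGen rank prank M' M ≤ phiGen rank prank M M'

/-! ## The (2,2)-E3-SAT construction

A (2,2)-E3-SAT instance with `n` variables and `m` clauses is given by
`lit : Fin m → Fin 3 → Fin n × Bool`, where `lit i k = (j, s)` means that the
`k`-th literal of clause `C_i` is the variable `v_j`, unnegated if `s = true`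
and negated if `s = false`. -/

/-- Every variable appears exactly twice unnegated and exactly twice negated. -/
def TwoTwo {n m : ℕ} (lit : Fin m → Fin 3 → Fin n × Bool) : Prop :=
  ∀ (j : Fin n) (s : Bool),
    (Finset.univ.filter fun p : Fin m × Fin 3 => lit p.1 p.2 = (j, s)).card = 2

/-- Applicants of `G_I`: `Sum.inl (j, true)` is `a_{j1}` (the unnegated side),
`Sum.inl (j, false)` is `a_{j2}` (the negated side), `Sum.inr (i, k)` is `x_{ik}`. -/
abbrev AI (n m : ℕ) := (Fin n × Bool) ⊕ (Fin m × Fin 3)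

/-- Posts of `G_I`: `Sum.inl (j, true)` is `b_{j1}`, `Sum.inl (j, false)` is `b_{j2}`,
`Sum.inr (Sum.inl i)` is `c_i`, and `Sum.inr (Sum.inr (i, k))` is `y_{ik}`. -/
abbrev BI (n m : ℕ) := (Fin n × Bool) ⊕ (Fin m ⊕ (Fin m × Fin 3))

/-- The edges of `G_I`: each variable gadget is a 4-cycle on `a_{j1}, a_{j2}, b_{j1}, b_{j2}`;
each `x_{ik}` is adjacent to `c_i` and to `y_{ik}`; and `y_{ik}` is joined by an
interconnecting edge to `a_{j1}` (resp. `a_{j2}`) if the `k`-th literal of `C_i`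
is `v_j` (resp. `¬ v_j`). -/
def EI {n m : ℕ} (lit : Fin m → Fin 3 → Fin n × Bool) : AI n m → BI n m → Prop
  | Sum.inl (j, _), Sum.inl (j', _) => j = j'
  | Sum.inl (j, t), Sum.inr (Sum.inr (i, k)) => lit i k = (j, t)
  | Sum.inl _, Sum.inr (Sum.inl _) => False
  | Sum.inr (i, _), Sum.inr (Sum.inl i') => i = i'
  | Sum.inr (i, k), Sum.inr (Sum.inr p) => p = (i, k)
  | Sum.inr _, Sum.inl _ => False

/-- The number of occurrences of variable `j` with sign `t` occurring (in the fixed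
lexicographic order on occurrences) strictly before the occurrence `(i, k)`;
used to order the two `y`-neighbors of `a_{jt}` in its preference list. -/
def occBefore {n m : ℕ} (lit : Fin m → Fin 3 → Fin n × Bool)
    (j : Fin n) (t : Bool) (i : Fin m) (k : Fin 3) : ℕ :=
  (Finset.univ.filter fun p : Fin m × Fin 3 =>
     lit p.1 p.2 = (j, t) ∧ (p.1 < i ∨ (p.1 = i ∧ p.2 < k))).card

/-- The applicants' (strict) preference lists of `G_I`, as a rank function
(lower rank = more preferred; the value on non-edges is irrelevant):
`x_{ik}` ranks `c_i` first and `y_{ik}` second; `a_{jt}` ranks `b_{j1}` first,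
its two interconnecting `y`-neighbors second and third (in a fixed order),
and `b_{j2}` fourth. -/
def rankI {n m : ℕ} (lit : Fin m → Fin 3 → Fin n × Bool) : AI n m → BI n m → ℕ
  | Sum.inl _, Sum.inl (_, s) => if s then 1 else 4
  | Sum.inl (j, t), Sum.inr (Sum.inr (i, k)) => 2 + occBefore lit j t i k
  | Sum.inl _, Sum.inr (Sum.inl _) => 0
  | Sum.inr _, Sum.inr (Sum.inl _) => 1
  | Sum.inr _, Sum.inr (Sum.inr _) => 2
  | Sum.inr _, Sum.inl _ => 0

/-- The posts' preference lists of `G_I`: each `y_{ik}` ranks `x_{ik}` first and its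
interconnecting `a`-neighbor second; each `c_i` puts its three neighbors
`x_{i1}, x_{i2}, x_{i3}` into a single tie, and each `b_{js}` puts its two neighbors
`a_{j1}, a_{j2}` into a single tie. -/
def prankI {n m : ℕ} : BI n m → AI n m → ℕ
  | Sum.inr (Sum.inr _), Sum.inr _ => 1
  | Sum.inr (Sum.inr _), Sum.inl _ => 2
  | _, _ => 1

/-- The matching built from a satisfying assignment `σ` together with a choice
`choice i` of a true literal in each clause `C_i`: if `σ v_j` is true take
`(a_{j1}, b_{j1}), (a_{j2}, b_{j2})`, otherwise `(a_{j1}, b_{j2}), (a_{j2}, b_{j1})`;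
in clause `C_i`, `x_{i,choice i}` is matched to `c_i`, the other two `x_{ik}` to their
`y_{ik}`, and `y_{i,choice i}` is left unmatched. No interconnecting edge is used. -/
def Msat {n m : ℕ} (σ : Fin n → Bool) (choice : Fin m → Fin 3) :
    AI n m → Option (BI n m)
  | Sum.inl (j, t) => some (Sum.inl (j, t == σ j))
  | Sum.inr (i, k) =>
      if k = choice i then some (Sum.inr (Sum.inl i))
      else some (Sum.inr (Sum.inr (i, k)))

/-- An applicant preferring `M` to `M'` is matched in `M`, and in `M'` is either unmatched
or matched to a worse post. -/
lemma aPrefers_iff {rank : A → B → ℕ} {M M' : A → Option B} {a : A} :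
    APrefers rank M M' a ↔
      ∃ b, M a = some b ∧ ∀ b', M' a = some b' → rank a b < rank a b' := by
  unfold APrefers
  cases M a <;> cases M' a <;> simp

lemma card_finset_le_card_subtype {α : Type*} [Finite α] {s : Finset α} {p : α → Prop}
    (h : ∀ x ∈ s, p x) : s.card ≤ Nat.card {x // p x} := by
  rw [← Nat.card_eq_finsetCard]
  exact Nat.card_mono (Set.toFinite {x | p x}) h

lemma card_subtype_le_card_finset {α : Type*} {s : Finset α} {p : α → Prop}
    (h : ∀ x, p x → x ∈ s) : Nat.card {x // p x} ≤ s.card := by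
  rw [← Nat.card_eq_finsetCard]
  exact Nat.card_mono (t := {x | x ∈ s}) s.finite_toSet h

/-- A popular matching `M` is not beaten: a set of voters for `M'` is at most as large as any
set containing all the voters for `M`. -/
lemma PopularGen.card_le [Finite A] [Finite B] {E : A → B → Prop} {rank : A → B → ℕ}
    {prank : B → A → ℕ} {M M' : A → Option B} (hpop : PopularGen E rank prank M)
    (hM' : IsMatching E M') {winA loseA : Finset A} {winB loseB : Finset B}
    (hwA : ∀ a ∈ winA, APrefers rank M' M a) (hlA : ∀ a, APrefers rank M M' a → a ∈ loseA)
    (hwB : ∀ b ∈ winB, BPrefersGen prank M' M b)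
    (hlB : ∀ b, BPrefersGen prank M M' b → b ∈ loseB) :
    winA.card + winB.card ≤ loseA.card + loseB.card :=
  calc winA.card + winB.card ≤ phiGen rank prank M' M :=
        add_le_add (card_finset_le_card_subtype hwA) (card_finset_le_card_subtype hwB)
    _ ≤ phiGen rank prank M M' := hpop.2 M' hM'
    _ ≤ loseA.card + loseB.card :=
        add_le_add (card_subtype_le_card_finset hlA) (card_subtype_le_card_finset hlB)

/-- In a popular matching no applicant can improve by moving to an unmatched post. -/
lemma PopularGen.le_of_not_postMatched [Finite A] [Finite B] {E : A → B → Prop}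
    {rank : A → B → ℕ} {prank : B → A → ℕ} {M : A → Option B}
    (hpop : PopularGen E rank prank M) {a : A} {b : B} (hE : E a b)
    (hfree : ¬ PostMatched M b) :
    ∃ b', M a = some b' ∧ rank a b' ≤ rank a b := by
  by_contra! himp
  obtain ⟨M', hM', hoth⟩ : ∃ M' : A → Option B, M' a = some b ∧ ∀ z, z = a ∨ M' z = M z :=
    ⟨Function.update M a (some b), by simp, fun z => by grind⟩
  obtain ⟨hedge, hinj⟩ := hpop.1
  simp only [PostMatched, not_exists] at hfree
  have h := hpop.card_le (M' := M') (winA := {a}) (loseA := ∅) (winB := {b})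
    (loseB := (M a).toFinset) ⟨by grind, by grind⟩
    (by simp only [aPrefers_iff]; grind)
    (by simp only [aPrefers_iff]; grind)
    (by simp only [BPrefersGen, PostMatched]; grind)
    (by simp only [BPrefersGen, PostMatched, Option.mem_toFinset, Option.mem_def]; grind)
  have : (M a).toFinset.card ≤ 1 := by cases M a <;> simp
  simp at h
  omega

/-- In a popular matching no post strictly prefers an unmatched neighbour to its partner. -/
lemma PopularGen.prank_le_of_unmatched [Finite A] [Finite B] {E : A → B → Prop}
    {rank : A → B → ℕ} {prank : B → A → ℕ} {M : A → Option B}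
    (hpop : PopularGen E rank prank M) {a x : A} {b : B} (hE : E x b)
    (ha : M a = some b) (hx : M x = none) : prank b a ≤ prank b x := by
  by_contra! himp
  obtain ⟨M', hM'x, hM'a, hoth⟩ : ∃ M' : A → Option B, M' x = some b ∧ M' a = none ∧
      ∀ z, z = a ∨ z = x ∨ M' z = M z :=
    ⟨Function.update (Function.update M a none) x (some b), by grind, by grind,
      fun z => by grind⟩
  obtain ⟨hedge, hinj⟩ := hpop.1
  have h := hpop.card_le (M' := M') (winA := {x}) (loseA := {a}) (winB := {b})
    (loseB := ∅) ⟨by grind, by grind⟩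
    (by simp only [aPrefers_iff]; grind)
    (by simp only [aPrefers_iff]; grind)
    (by simp only [BPrefersGen, PostMatched]; grind)
    (by simp only [BPrefersGen, PostMatched]; grind)
  simp at h

/-- A matching containing `a—y`, `a'—b`, `x—c`, `x'—y'` and leaving `b'` unmatched is beaten by
the one with `a—b`, `a'—b'`, `x—y`, `x'—c` instead when `a`, `x'` and `y` improve, and
`b` and `c` are indifferent. -/
lemma PopularGen.false_of_exchange [Finite A] [Finite B] {E : A → B → Prop}
    {rank : A → B → ℕ} {prank : B → A → ℕ} {M : A → Option B}
    (hpop : PopularGen E rank prank M) {a a' x x' : A} {b b' c y y' : B}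
    (ha : M a = some y) (ha' : M a' = some b) (hx : M x = some c) (hx' : M x' = some y')
    (hb' : ¬ PostMatched M b') (hby : b ≠ y) (hbc : b ≠ c) (hby' : b ≠ y') (hyc : y ≠ c)
    (hyy' : y ≠ y') (hcy' : c ≠ y') (hab : E a b) (hab' : E a' b') (hxy : E x y)
    (hxc : E x' c) (hra : rank a b < rank a y) (hrx : rank x' c < rank x' y')
    (hpy : prank y x < prank y a) (hpb : prank b a = prank b a')
    (hpc : prank c x' = prank c x) : False := by
  have hne : a ≠ a' ∧ a ≠ x ∧ a ≠ x' ∧ a' ≠ x ∧ a' ≠ x' ∧ x ≠ x' := by grind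
  obtain ⟨haa', hax, hax', ha'x, ha'x', hxx'⟩ := hne
  obtain ⟨M', hM'a, hM'a', hM'x, hM'x', hoth⟩ : ∃ M' : A → Option B, M' a = some b ∧
      M' a' = some b' ∧ M' x = some y ∧ M' x' = some c ∧
      ∀ z, z = a ∨ z = a' ∨ z = x ∨ z = x' ∨ M' z = M z :=
    ⟨Function.update (Function.update (Function.update (Function.update M x' (some c))
      x (some y)) a' (some b')) a (some b), by grind, by grind, by grind, by grind, by grind⟩
  obtain ⟨hedge, hinj⟩ := hpop.1
  simp only [PostMatched, not_exists] at hb'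
  have h := hpop.card_le (M' := M') (winA := {a, x'}) (loseA := {a', x}) (winB := {b', y})
    (loseB := {y'}) ⟨by grind, by grind⟩
    (by simp only [aPrefers_iff]; grind)
    (by simp only [aPrefers_iff]; grind)
    (by simp only [BPrefersGen, PostMatched]; grind)
    (by simp only [BPrefersGen, PostMatched]; grind)
  rw [Finset.card_pair hax', Finset.card_pair ha'x, Finset.card_pair (by grind),
    Finset.card_singleton] at h
  omega

section Gadgets

variable {n m : ℕ} {lit : Fin m → Fin 3 → Fin n × Bool} {M : AI n m → Option (BI n m)}

lemma occBefore_lt_two (htwo : TwoTwo lit) {j : Fin n} {t : Bool} {i : Fin m} {k : Fin 3}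
    (h : lit i k = (j, t)) : occBefore lit j t i k < 2 := by
  rw [← htwo j t]
  refine Finset.card_lt_card (Finset.ssubset_iff_of_subset ?_ |>.2 ⟨(i, k), ?_, ?_⟩)
  · exact fun p hp => by
      simp only [Finset.mem_filter, Finset.mem_univ, true_and] at hp ⊢
      exact hp.1
  · simpa using h
  · simp

/-- The posts of `G_I` that a matched variable applicant can have. -/
lemma IsMatching.inl_cases (hM : IsMatching (EI lit) M) {j : Fin n} {t : Bool} {b : BI n m}
    (h : M (Sum.inl (j, t)) = some b) :
    (∃ s, b = Sum.inl (j, s)) ∨ ∃ i k, b = Sum.inr (Sum.inr (i, k)) ∧ lit i k = (j, t) := by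
  have hE := hM.1 _ _ h
  rcases b with ⟨j', s⟩ | i | ⟨i, k⟩
  · exact .inl ⟨s, by rw [show j = j' from hE]⟩
  · exact hE.elim
  · exact .inr ⟨i, k, rfl, hE⟩

/-- The posts of `G_I` that a matched clause applicant can have. -/
lemma IsMatching.inr_cases (hM : IsMatching (EI lit) M) {i : Fin m} {k : Fin 3} {b : BI n m}
    (h : M (Sum.inr (i, k)) = some b) :
    b = Sum.inr (Sum.inl i) ∨ b = Sum.inr (Sum.inr (i, k)) := by
  have hE := hM.1 _ _ h
  rcases b with ⟨j', s⟩ | i' | p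
  · exact hE.elim
  · exact .inl (by rw [show i = i' from hE])
  · exact .inr (by rw [show p = (i, k) from hE])

/-- The applicants of `G_I` that a matched variable post can have. -/
lemma IsMatching.exists_of_postMatched_inl (hM : IsMatching (EI lit) M) {j : Fin n} {s : Bool}
    (h : PostMatched M (Sum.inl (j, s))) : ∃ t, M (Sum.inl (j, t)) = some (Sum.inl (j, s)) := by
  obtain ⟨⟨j', t⟩ | p, ha⟩ := h
  · obtain rfl : j' = j := hM.1 _ _ ha
    exact ⟨t, ha⟩
  · exact (hM.1 _ _ ha).elim

/-- In a popular matching each `c_i` is matched to some `x_{ik}`, and the other two `x_{ik'}`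
are matched to their `y_{ik'}`. -/
lemma PopularGen.exists_clause (hpop : PopularGen (EI lit) (rankI lit) prankI M) (i : Fin m) :
    ∃ k, M (Sum.inr (i, k)) = some (Sum.inr (Sum.inl i)) ∧
      ∀ k', k' ≠ k → M (Sum.inr (i, k')) = some (Sum.inr (Sum.inr (i, k'))) := by
  have hM := hpop.1
  have hc : PostMatched M (Sum.inr (Sum.inl i)) := by
    by_contra hfree
    obtain ⟨b, hb, hle⟩ :=
      hpop.le_of_not_postMatched (show EI lit (Sum.inr (i, 0)) (Sum.inr (Sum.inl i)) from rfl)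
        hfree
    rcases hM.inr_cases hb with rfl | rfl
    · exact hfree ⟨_, hb⟩
    · simp [rankI] at hle
  obtain ⟨⟨j, t⟩ | ⟨i', k⟩, hx⟩ := hc
  · exact (hM.1 _ _ hx).elim
  obtain rfl : i' = i := hM.1 _ _ hx
  refine ⟨k, hx, fun k' hk' => ?_⟩
  have hE : EI lit (Sum.inr (i', k')) (Sum.inr (Sum.inr (i', k'))) := rfl
  cases hx' : M (Sum.inr (i', k')) with
  | some b =>
    rcases hM.inr_cases hx' with rfl | rfl
    · exact (hk' (by simpa using hM.2 _ _ _ hx' hx)).elim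
    · rfl
  | none =>
    by_cases hy : PostMatched M (Sum.inr (Sum.inr (i', k')))
    · obtain ⟨⟨j, t⟩ | p, ha⟩ := hy
      · exact absurd (hpop.prank_le_of_unmatched hE ha hx') (by simp [prankI])
      · obtain rfl : (i', k') = p := hM.1 _ _ ha
        simp [hx'] at ha
    · obtain ⟨b, hb, -⟩ := hpop.le_of_not_postMatched hE hy
      simp [hx'] at hb

lemma PopularGen.postMatched_inl_true (hpop : PopularGen (EI lit) (rankI lit) prankI M)
    (j : Fin n) : PostMatched M (Sum.inl (j, true)) := by
  by_contra hfree
  obtain ⟨b, hb, hle⟩ :=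
    hpop.le_of_not_postMatched
      (show EI lit (Sum.inl (j, true)) (Sum.inl (j, true)) from rfl) hfree
  rcases hpop.1.inl_cases hb with ⟨_ | _, rfl⟩ | ⟨i, k, rfl, -⟩
  · simp [rankI] at hle
  · exact hfree ⟨_, hb⟩
  · simp [rankI] at hle
    omega

lemma PopularGen.postMatched_inl_false (hpop : PopularGen (EI lit) (rankI lit) prankI M)
    (j : Fin n) : PostMatched M (Sum.inl (j, false)) := by
  have hM := hpop.1
  by_contra hfree
  obtain ⟨t, ht⟩ := hM.exists_of_postMatched_inl (hpop.postMatched_inl_true j)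
  obtain ⟨b, hb, -⟩ :=
    hpop.le_of_not_postMatched
      (show EI lit (Sum.inl (j, !t)) (Sum.inl (j, false)) from rfl) hfree
  rcases hM.inl_cases hb with ⟨_ | _, rfl⟩ | ⟨i, k, rfl, -⟩
  · exact hfree ⟨_, hb⟩
  · simpa using hM.2 _ _ _ ht hb
  · obtain ⟨k₀, hc, hy⟩ := hpop.exists_clause i
    obtain rfl : k = k₀ := by
      by_contra hk
      simpa using hM.2 _ _ _ hb (hy k hk)
    obtain ⟨k', hk'⟩ := exists_ne k
    refine hpop.false_of_exchange hb ht hc (hy k' hk') hfree (by simp) (by simp) (by simp)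
      (by simp) (by simpa using hk'.symm) (by simp) (show EI lit _ _ from rfl)
      (show EI lit _ _ from rfl) (show EI lit _ _ from rfl) (show EI lit _ _ from rfl)
      ?_ ?_ ?_ rfl rfl
    · simp only [rankI, if_true]
      omega
    · simp [rankI]
    · simp [prankI]

lemma PopularGen.variable_gadget (hpop : PopularGen (EI lit) (rankI lit) prankI M) (j : Fin n) :
    (M (Sum.inl (j, true)) = some (Sum.inl (j, true)) ∧
        M (Sum.inl (j, false)) = some (Sum.inl (j, false))) ∨
      (M (Sum.inl (j, true)) = some (Sum.inl (j, false)) ∧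
        M (Sum.inl (j, false)) = some (Sum.inl (j, true))) := by
  obtain ⟨t, ht⟩ := hpop.1.exists_of_postMatched_inl (hpop.postMatched_inl_true j)
  obtain ⟨s, hs⟩ := hpop.1.exists_of_postMatched_inl (hpop.postMatched_inl_false j)
  cases t <;> cases s <;> simp_all

lemma PopularGen.inl_ne_inr (hpop : PopularGen (EI lit) (rankI lit) prankI M) (j : Fin n)
    (t : Bool) (q : Fin m ⊕ (Fin m × Fin 3)) : M (Sum.inl (j, t)) ≠ some (Sum.inr q) := by
  rcases hpop.variable_gadget j with h | h <;> cases t <;> simp [h]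

lemma PopularGen.postMatched_iff (hpop : PopularGen (EI lit) (rankI lit) prankI M) (i : Fin m)
    (k : Fin 3) : PostMatched M (Sum.inr (Sum.inr (i, k))) ↔
      M (Sum.inr (i, k)) = some (Sum.inr (Sum.inr (i, k))) := by
  refine ⟨?_, fun h => ⟨_, h⟩⟩
  rintro ⟨⟨j, t⟩ | p, ha⟩
  · exact (hpop.inl_ne_inr j t _ ha).elim
  · obtain rfl : (i, k) = p := hpop.1.1 _ _ ha
    exact ha

end Gadgets

/-- Every popular matching `M` of `G_I` contains no interconnecting
edge; restricted to each variable gadget it is one of the two perfect matchings on the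
4-cycle; and in each clause gadget exactly one of `y_{i1}, y_{i2}, y_{i3}` is unmatched,
its interconnecting neighbor `a_{jt}` being matched to `b_{j1}`. -/
theorem popular_matching_structure (n m : ℕ) (lit : Fin m → Fin 3 → Fin n × Bool)
    (htwo : TwoTwo lit)
    (M : AI n m → Option (BI n m))
    (hpop : PopularGen (EI lit) (rankI lit) prankI M) :
    (∀ (j : Fin n) (t : Bool) (i : Fin m) (k : Fin 3),
        M (Sum.inl (j, t)) ≠ some (Sum.inr (Sum.inr (i, k)))) ∧
    (∀ j : Fin n,
        (M (Sum.inl (j, true)) = some (Sum.inl (j, true)) ∧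
          M (Sum.inl (j, false)) = some (Sum.inl (j, false))) ∨
        (M (Sum.inl (j, true)) = some (Sum.inl (j, false)) ∧
          M (Sum.inl (j, false)) = some (Sum.inl (j, true)))) ∧
    (∀ i : Fin m, ∃! k : Fin 3, ¬ PostMatched M (Sum.inr (Sum.inr (i, k)))) ∧
    (∀ (i : Fin m) (k : Fin 3), ¬ PostMatched M (Sum.inr (Sum.inr (i, k))) →
        M (Sum.inl (lit i k)) = some (Sum.inl ((lit i k).1, true))) := by
  refine ⟨fun j t i k => hpop.inl_ne_inr j t _, hpop.variable_gadget, fun i => ?_,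
    fun i k hk => ?_⟩
  · obtain ⟨k, hc, hy⟩ := hpop.exists_clause i
    simp only [hpop.postMatched_iff]
    exact ⟨k, by simp [hc], fun k' hk' => by_contra fun hne => hk' (hy k' hne)⟩
  · obtain ⟨b, hb, hle⟩ := hpop.le_of_not_postMatched
      (show EI lit (Sum.inl (lit i k)) (Sum.inr (Sum.inr (i, k))) from rfl) hk
    obtain ⟨_ | _, rfl⟩ | ⟨i', k', rfl, -⟩ := hpop.1.inl_cases hb
    · have := occBefore_lt_two htwo (show lit i k = ((lit i k).1, (lit i k).2) from rfl)
      simp only [rankI, Bool.false_eq_true, if_false] at hle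
      omega
    · exact hb
    · exact (hpop.inl_ne_inr _ _ _ hb).elim
end
end

section
/- Let G be the complete bipartite graph between A = {a1, a2, a3} and B = {b1, b2, b3}, where each a_i ranks b1 first, b2 second and b3 third, and each b_i puts a1, a2, a3 into a single tie. Then G admits no popular matching: for every matching M of G there exists a matching M' with φ(M',M) > φ(M,M'). -/
open Classical

noncomputable section

variable {A B : Type*}

/-- Every applicant ranks `b1` first, `b2` second and `b3` third. -/
def rank14 : Fin 3 → Fin 3 → ℕ := fun _ b => (b : ℕ) + 1

/-- Matching an unmatched applicant to an unmatched post makes some vertex better off and no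
vertex worse off. -/
theorem phi_lt_phi_update [Finite A] [Finite B] (rank : A → B → ℕ) (M : A → Option B) {a : A}
    {b : B} (ha : M a = none) (hb : ¬ PostMatched M b) :
    phi rank M (Function.update M a (some b)) < phi rank (Function.update M a (some b)) M := by
  have hA : IsEmpty {x : A // APrefers rank M (Function.update M a (some b)) x} := by
    refine ⟨fun ⟨x, hx⟩ => ?_⟩
    by_cases hxa : x = a
    · subst hxa
      simp [APrefers, ha] at hx
    · cases hM : M x <;> simp [APrefers, hxa, hM] at hx
  have hB : IsEmpty {y : B // BPrefers M (Function.update M a (some b)) y} := by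
    refine ⟨fun ⟨y, ⟨x, hx⟩, hy⟩ => hy ⟨x, ?_⟩⟩
    have hxa : x ≠ a := by
      rintro rfl
      simp [ha] at hx
    simpa [hxa] using hx
  have hpos : 0 < Nat.card {y : B // BPrefers (Function.update M a (some b)) M y} :=
    Nat.card_pos_iff.2 ⟨⟨b, ⟨a, by simp⟩, hb⟩, inferInstance⟩
  unfold phi
  rw [Nat.card_of_isEmpty, Nat.card_of_isEmpty]
  omega

/-- A matching stays a matching when an unmatched post is assigned to some applicant. -/
theorem IsMatching.update {E : A → B → Prop} {M : A → Option B} (hM : IsMatching E M) {a : A}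
    {b : B} (hE : E a b) (hb : ¬ PostMatched M b) :
    IsMatching E (Function.update M a (some b)) := by
  unfold PostMatched at hb
  obtain ⟨hedge, hinj⟩ := hM
  constructor <;> intros <;> grind [Function.update_apply]

/-- If every applicant is matched, with all posts used, then promoting everybody by one post
cyclically is more popular. -/
theorem phi_lt_phi_cyclic_shift (σ : Equiv.Perm (Fin 3)) :
    phi rank14 (fun a => some (σ a)) (fun a => some (σ a - 1)) <
      phi rank14 (fun a => some (σ a - 1)) (fun a => some (σ a)) := by
  have hB : IsEmpty {y : Fin 3 //
      BPrefers (fun a => some (σ a)) (fun a => some (σ a - 1)) y} :=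
    ⟨fun ⟨y, _, hy⟩ => hy ⟨σ.symm (y + 1), by simp⟩⟩
  have hworse : Nat.card {a : Fin 3 //
      APrefers rank14 (fun a => some (σ a)) (fun a => some (σ a - 1)) a} = 1 := by
    rw [Nat.card_congr (σ.subtypeEquiv (q := fun b => b = 0) fun a => ?_)]
    · simp
    · simp only [APrefers, rank14]
      generalize σ a = b
      fin_cases b <;> simp
  have hbetter : Nat.card {a : Fin 3 //
      APrefers rank14 (fun a => some (σ a - 1)) (fun a => some (σ a)) a} = 2 := by
    rw [Nat.card_congr (σ.subtypeEquiv (q := fun b => b ≠ 0) fun a => ?_)]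
    · simp [Nat.card_eq_fintype_card, Fintype.card_subtype_compl]
    · simp only [APrefers, rank14]
      generalize σ a = b
      fin_cases b <;> simp
  unfold phi
  rw [hworse, hbetter, Nat.card_of_isEmpty]
  omega

/-- In the complete bipartite graph between three applicants and three
posts, where every applicant ranks `b1 > b2 > b3` and every post puts all applicants
into a single tie, no matching is popular: for every matching `M` there is a matching
`M'` with `φ(M', M) > φ(M, M')`. -/
theorem no_popular_matching_example :
    ∀ M : Fin 3 → Option (Fin 3),
      IsMatching (fun _ _ => True) M →
      ∃ M' : Fin 3 → Option (Fin 3),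
        IsMatching (fun _ _ => True) M' ∧
          phi rank14 M M' < phi rank14 M' M := by
  intro M hM
  by_cases hfull : ∀ a, ∃ b, M a = some b
  · choose f hf using hfull
    have hinj : Function.Injective f := fun a a' h =>
      hM.2 a a' (f a) (hf a) (by rw [hf a', h])
    let σ : Equiv.Perm (Fin 3) := Equiv.ofBijective f (Finite.injective_iff_bijective.1 hinj)
    obtain rfl : M = fun a => some (σ a) := funext hf
    refine ⟨fun a => some (σ a - 1), ⟨fun _ _ _ => trivial, fun a a' b h h' => ?_⟩,
      phi_lt_phi_cyclic_shift σ⟩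
    simpa using h.trans h'.symm
  · push Not at hfull
    obtain ⟨a, ha⟩ := hfull
    have ha : M a = none := Option.eq_none_iff_forall_ne_some.2 ha
    obtain ⟨b, hb⟩ : ∃ b, ¬ PostMatched M b := by
      by_contra! hall
      choose g hg using hall
      have hinj : Function.Injective g := fun b b' h => by
        simpa [h, hg b'] using (hg b).symm
      obtain ⟨b, rfl⟩ := Finite.surjective_of_injective hinj a
      simp [hg b] at ha
    exact ⟨_, hM.update trivial hb, phi_lt_phi_update rank14 M ha hb⟩
end
end

section
/- Let G be the bipartite graph on A = {a1, a2, a3, x1, x2} and B = {b1, b2, b3, y1, y2, y3} where a1 ranks b1 > b2, a2 ranks b1 > y1 > b2, a3 ranks b1 > b2 > b3, x1 ranks y1 > y2 > y3, x2 ranks y1 > y2, and each post puts all its neighbors into a single tie. Then M = {(a1,b1), (a2,b2), (a3,b3), (x2,y1), (x1,y2)} and M' = {(a1,b2), (a2,b1), (a3,b3), (x1,y1), (x2,y2)} are both popular matchings of G, but the matching N = {(a1,b1), (a2,b2), (a3,b3), (x1,y1), (x2,y2)}, contained in M ∪ M', is not popular. -/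
open Classical

noncomputable section

variable {A B : Type*}

/-- The rank matrix of the example: rows are the applicants `a1, a2, a3, x1, x2`,
columns are the posts `b1, b2, b3, y1, y2, y3`; an entry `0` means "not a neighbor".
So `a1 : b1 > b2`, `a2 : b1 > y1 > b2`, `a3 : b1 > b2 > b3`, `x1 : y1 > y2 > y3`,
`x2 : y1 > y2`. -/
def rank16 : Fin 5 → Fin 6 → ℕ :=
  ![![1, 2, 0, 0, 0, 0],
    ![1, 3, 0, 2, 0, 0],
    ![1, 2, 3, 0, 0, 0],
    ![0, 0, 0, 1, 2, 3],
    ![0, 0, 0, 1, 2, 0]]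

theorem phi_eq_sum [Fintype A] [Fintype B] (rank : A → B → ℕ) (M M' : A → Option B) :
    phi rank M M' = (∑ a, if APrefers rank M M' a then 1 else 0) +
      ∑ b, if BPrefers M M' b then 1 else 0 := by
  simp [phi, Nat.card_eq_fintype_card, Fintype.card_subtype]

/-- Charging along a matching: if vertex weights are nonnegative on unmatched vertices and
sum to a nonnegative number along each matched pair, then their total is nonnegative. -/
theorem sum_add_sum_nonneg_of_isMatching [Fintype A] [Fintype B] {E : A → B → Prop}
    {M : A → Option B} (hM : IsMatching E M) (g : A → ℤ) (h : B → ℤ)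
    (hg : ∀ a, M a = none → 0 ≤ g a) (hh : ∀ b, ¬ PostMatched M b → 0 ≤ h b)
    (hgh : ∀ a b, M a = some b → 0 ≤ g a + h b) :
    0 ≤ ∑ a, g a + ∑ b, h b := by
  have hB : ∑ b, ∑ a, (if M a = some b then h b else 0) ≤ ∑ b, h b := by
    refine Finset.sum_le_sum fun b _ => ?_
    by_cases hb : PostMatched M b
    · obtain ⟨a, ha⟩ := hb
      rw [Finset.sum_eq_single a]
      · simp [ha]
      · intro a' _ hne
        exact if_neg fun ha' => hne (hM.2 _ _ _ ha' ha)
      · simp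
    · rw [Finset.sum_eq_zero fun a _ => if_neg fun ha => hb ⟨a, ha⟩]
      exact hh b hb
  have hA : 0 ≤ ∑ a, (g a + ∑ b, if M a = some b then h b else 0) := by
    refine Finset.sum_nonneg fun a _ => ?_
    cases ha : M a with
    | none => simpa using hg a ha
    | some b => simpa using hgh a b ha
  rw [Finset.sum_add_distrib, Finset.sum_comm] at hA
  linarith

/-- A dual certificate `(α, β)` of nonpositive total weight proves that an applicant-perfect
matching is popular. -/
theorem popular_of_dual_certificate [Fintype A] [Fintype B] {E : A → B → Prop}
    {rank : A → B → ℕ} {m : A → B} (hm : IsMatching E fun a => some (m a))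
    (α : A → ℤ) (β : B → ℤ) (hsum : ∑ a, α a + ∑ b, β b ≤ 0)
    (hα : ∀ a, -1 ≤ α a) (hβ : ∀ b, -1 ≤ β b) (hβ_unmatched : ∀ b, (∀ a, m a ≠ b) → 0 ≤ β b)
    (hE : ∀ a b, E a b → ((rank a (m a) : ℤ) - rank a b).sign ≤ α a + β b)
    (hE_unmatched : ∀ a b, E a b → (∀ a', m a' ≠ b) →
      ((rank a (m a) : ℤ) - rank a b).sign + 1 ≤ α a + β b) :
    Popular E rank fun a => some (m a) := by
  refine ⟨hm, fun M hM => ?_⟩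
  set N : A → Option B := fun a => some (m a) with hN
  have hPost : ∀ b, PostMatched N b ↔ ∃ a, m a = b := by simp [PostMatched, hN]
  have key := sum_add_sum_nonneg_of_isMatching hM
    (fun a => α a - ((if APrefers rank M N a then 1 else 0) -
      if APrefers rank N M a then 1 else 0))
    (fun b => β b - ((if BPrefers M N b then 1 else 0) - if BPrefers N M b then 1 else 0))
    (fun a ha => by
      have := hα a
      simp only [APrefers, ha, hN, if_true, if_false]
      linarith)
    (fun b hb => by
      by_cases hb' : ∃ a, m a = b
      · have := hβ b
        simp only [BPrefers, hPost, hb, hb', not_true, not_false_iff, and_true, and_false,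
          if_true, if_false]
        linarith
      · have := hβ_unmatched b (by simpa using hb')
        simpa [BPrefers, hPost, hb, hb'] using this)
    (fun a b hab => by
      have hEab := hM.1 a b hab
      have hb : PostMatched M b := ⟨a, hab⟩
      have hvote : ((if APrefers rank M N a then 1 else 0) -
          if APrefers rank N M a then 1 else 0 : ℤ) = ((rank a (m a) : ℤ) - rank a b).sign := by
        simp only [APrefers, hab, hN]
        rcases lt_trichotomy (rank a b) (rank a (m a)) with h | h | h
        · rw [Int.sign_eq_one_of_pos (by omega)]
          simp [h, h.le]
        · simp [h]
        · rw [Int.sign_eq_neg_one_of_neg (by omega)]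
          simp [h, h.le]
      rw [hvote]
      by_cases hb' : ∃ a, m a = b
      · have := hE a b hEab
        simp only [BPrefers, hPost, hb, hb', not_true, and_false, if_false]
        linarith
      · have := hE_unmatched a b hEab (by simpa using hb')
        simp only [BPrefers, hPost, hb, hb', not_false_iff, and_true, false_and,
          if_true, if_false, not_true]
        linarith)
  rw [Finset.sum_sub_distrib, Finset.sum_sub_distrib, Finset.sum_sub_distrib,
    Finset.sum_sub_distrib] at key
  rw [phi_eq_sum, phi_eq_sum, ← Int.ofNat_le]
  push_cast
  linarith

theorem isMatching_some_of_injective {E : A → B → Prop} {m : A → B} (hE : ∀ a, E a (m a))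
    (hm : Function.Injective m) : IsMatching E fun a => some (m a) := by
  refine ⟨fun a b h => ?_, fun a a' b h h' => hm ?_⟩
  · cases h
    exact hE a
  · exact Option.some_injective _ (h.trans h'.symm)

/-- Both `M = {(a1,b1), (a2,b2), (a3,b3), (x1,y2), (x2,y1)}` and
`M' = {(a1,b2), (a2,b1), (a3,b3), (x1,y1), (x2,y2)}` are popular matchings of this
instance, but the matching `N = {(a1,b1), (a2,b2), (a3,b3), (x1,y1), (x2,y2)}`
contained in their union is a matching that is not popular. -/
theorem example_union_of_popular_not_popular :
    Popular (fun a b => rank16 a b ≠ 0) rank16 (fun a => some (![0, 1, 2, 4, 3] a)) ∧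
    Popular (fun a b => rank16 a b ≠ 0) rank16 (fun a => some (![1, 0, 2, 3, 4] a)) ∧
    IsMatching (fun a b => rank16 a b ≠ 0) (fun a : Fin 5 => some (![0, 1, 2, 3, 4] a)) ∧
    ¬ Popular (fun a b => rank16 a b ≠ 0) rank16 (fun a => some (![0, 1, 2, 3, 4] a)) := by
  refine ⟨popular_of_dual_certificate (isMatching_some_of_injective (by decide) (by decide))
      ![-1, 0, 1, 0, -1] ![1, 0, -1, 1, 0, 0] (by decide) (by decide) (by decide) (by decide)
      (by decide) (by decide),
    popular_of_dual_certificate (isMatching_some_of_injective (by decide) (by decide))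
      ![0, -1, 1, 0, 1] ![1, 0, -1, 0, -1, 0] (by decide) (by decide) (by decide) (by decide)
      (by decide) (by decide),
    isMatching_some_of_injective (by decide) (by decide), fun h => ?_⟩
  have hle := h.2 (fun a => some (![0, 3, 1, 5, 4] a))
    (isMatching_some_of_injective (by decide) (by decide))
  simp only [phi_eq_sum, Fin.sum_univ_five, Fin.sum_univ_six] at hle
  simp [APrefers, BPrefers, PostMatched, rank16, Fin.exists_fin_succ] at hle
end
end

section
/- Let G = (A ∪ B, E) be a bipartite graph in which every vertex on both sides has a strict preference list ranking its neighbors. Then every stable matching of G is popular. -/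
open Classical

noncomputable section

variable {A B : Type*}

/-- A matching `M` is stable if no edge of `E \ M` blocks it: there is no edge `(a, b)`
such that `a` is unmatched or prefers `b` to `M a`, and `b` is unmatched or prefers
`a` to its partner. -/
def IsStable (E : A → B → Prop) (rank : A → B → ℕ) (prank : B → A → ℕ)
    (M : A → Option B) : Prop :=
  IsMatching E M ∧
    ∀ a b, E a b → M a ≠ some b →
      ¬ ((M a = none ∨ ∃ b', M a = some b' ∧ rank a b < rank a b') ∧
         (¬ PostMatched M b ∨ ∃ a', M a' = some b ∧ prank b a < prank b a'))

/-- If `M` is stable, `M'` is a matching and `M'` assigns `b` to an applicant who prefers `M'`,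
then `b` prefers `M`. -/
theorem IsStable.bPrefersGen_of_aPrefers {E : A → B → Prop} {rank : A → B → ℕ}
    {prank : B → A → ℕ}
    (hstrict : ∀ b a a', E a b → E a' b → prank b a = prank b a' → a = a')
    {M M' : A → Option B} (hM : IsStable E rank prank M) (hM' : IsMatching E M')
    {a : A} (ha : APrefers rank M' M a) :
    ∃ b, M' a = some b ∧ BPrefersGen prank M M' b := by
  cases hb : M' a with
  | none => simp [APrefers, hb] at ha
  | some b =>
    refine ⟨b, rfl, ?_⟩
    have hE := hM'.1 a b hb
    have hfst : M a = none ∨ ∃ b', M a = some b' ∧ rank a b < rank a b' := by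
      cases hc : M a with
      | none => exact Or.inl rfl
      | some c => exact Or.inr ⟨c, rfl, by simpa [APrefers, hb, hc] using ha⟩
    have hne : M a ≠ some b := by
      rcases hfst with h | ⟨c, h, hlt⟩
      · simp [h]
      · rw [h]
        rintro ⟨⟩
        exact lt_irrefl _ hlt
    have hsnd := fun h => hM.2 a b hE hne ⟨hfst, h⟩
    obtain ⟨a', ha'⟩ : PostMatched M b := by
      by_contra h
      exact hsnd (Or.inl h)
    refine Or.inr ⟨a', a, ha', hb, lt_of_le_of_ne ?_ ?_⟩
    · by_contra! h
      exact hsnd (Or.inr ⟨a', ha', h⟩)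
    · intro h
      exact hne (hstrict b a' a (hM.1.1 _ _ ha') hE h ▸ ha')

/-- If `M` is stable, `M'` is a matching and the post `b` prefers `M'`, then the partner of `b`
in `M'` exists and prefers `M`. -/
theorem IsStable.aPrefers_of_bPrefersGen {E : A → B → Prop} {rank : A → B → ℕ}
    {prank : B → A → ℕ} (hstrict : StrictRanks E rank)
    {M M' : A → Option B} (hM : IsStable E rank prank M) (hM' : IsMatching E M')
    {b : B} (hb : BPrefersGen prank M' M b) :
    ∃ a, M' a = some b ∧ APrefers rank M M' a := by
  obtain ⟨a, ha, hsnd⟩ : ∃ a, M' a = some b ∧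
      (¬ PostMatched M b ∨ ∃ a', M a' = some b ∧ prank b a < prank b a') := by
    rcases hb with ⟨⟨a, ha⟩, h⟩ | ⟨a, a', ha, ha', hlt⟩
    · exact ⟨a, ha, Or.inl h⟩
    · exact ⟨a, ha, Or.inr ⟨a', ha', hlt⟩⟩
  refine ⟨a, ha, ?_⟩
  have hE := hM'.1 a b ha
  have hne : M a ≠ some b := by
    intro h
    rcases hsnd with h' | ⟨a', ha', hlt⟩
    · exact h' ⟨a, h⟩
    · rw [hM.1.2 a a' b h ha'] at hlt
      exact lt_irrefl _ hlt
  have hfst := fun h => hM.2 a b hE hne ⟨h, hsnd⟩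
  cases hc : M a with
  | none => exact absurd (Or.inl hc) hfst
  | some c =>
    simp only [APrefers, hc, ha]
    refine lt_of_le_of_ne ?_ ?_
    · by_contra! h
      exact hfst (Or.inr ⟨c, hc, h⟩)
    · intro h
      exact hne (hstrict a c b (hM.1.1 _ _ hc) hE h ▸ hc)

/-- In a bipartite graph where every vertex on both sides has a strict
preference list, every stable matching is popular. -/
theorem stable_is_popular
    [Fintype A] [Fintype B]
    (E : A → B → Prop) (rank : A → B → ℕ) (prank : B → A → ℕ)
    (hstrict : StrictRanks E rank)
    (hstrict' : ∀ b a a', E a b → E a' b → prank b a = prank b a' → a = a')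
    (M : A → Option B) (hstab : IsStable E rank prank M) :
    PopularGen E rank prank M := by
  refine ⟨hstab.1, fun M' hM' => ?_⟩
  choose f hf hfM using fun a : {a : A // APrefers rank M' M a} =>
    hstab.bPrefersGen_of_aPrefers hstrict' hM' a.2
  choose g hg hgM using fun b : {b : B // BPrefersGen prank M' M b} =>
    hstab.aPrefers_of_bPrefersGen hstrict hM' b.2
  have hA : Nat.card {a : A // APrefers rank M' M a} ≤
      Nat.card {b : B // BPrefersGen prank M M' b} := by
    refine Nat.card_le_card_of_injective (fun a => ⟨f a, hfM a⟩) fun a a' h => Subtype.ext ?_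
    have h' : f a = f a' := congrArg Subtype.val h
    exact hM'.2 _ _ (f a) (hf a) (h' ▸ hf a')
  have hB : Nat.card {b : B // BPrefersGen prank M' M b} ≤
      Nat.card {a : A // APrefers rank M M' a} := by
    refine Nat.card_le_card_of_injective (fun b => ⟨g b, hgM b⟩) fun b b' h => Subtype.ext ?_
    have h' : g b = g b' := congrArg Subtype.val h
    exact Option.some_injective _ ((hg b).symm.trans (h' ▸ hg b'))
  unfold phiGen
  omega
end
end

section
/- Let G = (A ∪ B, E) be an instance of the 1-sided popular matching problem, where each applicant a ∈ A has a strict preference list and only applicants vote. A matching M of G is popular if and only if: (i) every post b ∈ F is matched in M to an applicant a with f(a) = b; and (ii) every applicant a with r_a < ∞ is matched in M to either f(a) or to its neighbor of rank r_a, and every applicant a with r_a = ∞ is either matched to f(a) or unmatched. -/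
open Classical

noncomputable section

variable {A B : Type*}

/-- `rVal E rank F a` is the rank of `a`'s most preferred neighbor outside the
set `F` of top posts, and `⊤` (infinity) if all of `a`'s neighbors lie in `F`. -/
def rVal (E : A → B → Prop) (rank : A → B → ℕ) (F : Set B) (a : A) : ℕ∞ :=
  sInf {x : ℕ∞ | ∃ b, E a b ∧ b ∉ F ∧ x = (rank a b : ℕ∞)}

/-- A matching `M` together with a partition `⟨P1, P2, P3⟩` of the posts `B` is
well-structured. Here `Set.range f` is the set `F` of top posts. -/
structure WellStructured (E : A → B → Prop) (rank : A → B → ℕ) (f : A → B)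
    (M : A → Option B) (P1 P2 P3 : Set B) : Prop where
  union_eq : P1 ∪ P2 ∪ P3 = Set.univ
  disj12 : Disjoint P1 P2
  disj13 : Disjoint P1 P3
  disj23 : Disjoint P2 P3
  P1_subset_F : P1 ⊆ Set.range f
  P3_disjoint_F : Disjoint P3 (Set.range f)
  matched_P12 : ∀ b ∈ P1 ∪ P2, PostMatched M b
  unmatched_nbrs : ∀ a, M a = none → ∀ b, E a b → b ∈ P1
  pair_P1 : ∀ a b, M a = some b → b ∈ P1 → b = f a ∧ ∀ b', E a b' → b' ∉ P3
  pair_P2 : ∀ a b, M a = some b → b ∈ P2 →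
    (∀ b', E a b' → b' ∈ P2 → rank a b ≤ rank a b') ∧
      (rank a b : ℕ∞) ≤ rVal E rank (Set.range f) a
  pair_P3 : ∀ a b, M a = some b → b ∈ P3 →
    ∀ b', E a b' → b' ∈ P3 → rank a b ≤ rank a b'

/-- Number of applicants preferring `M` to `M'` (in the 1-sided model only applicants vote). -/
def phiOne (rank : A → B → ℕ) (M M' : A → Option B) : ℕ :=
  Nat.card {a : A // APrefers rank M M' a}

/-- `M` is a popular matching in the 1-sided voting model. -/
def PopularOne (E : A → B → Prop) (rank : A → B → ℕ) (M : A → Option B) : Prop :=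
  IsMatching E M ∧ ∀ M', IsMatching E M' → phiOne rank M' M ≤ phiOne rank M M'

theorem phiOne_eq_ncard (rank : A → B → ℕ) (M M' : A → Option B) :
    phiOne rank M M' = {a | APrefers rank M M' a}.ncard := rfl

theorem APrefers.of_eq_some {rank : A → B → ℕ} {M M' : A → Option B} {a : A} {c : B}
    (hc : M a = some c) (h : ∀ b, M' a = some b → rank a c < rank a b) :
    APrefers rank M M' a := by
  unfold APrefers
  rw [hc]
  cases hb : M' a with
  | none => trivial
  | some b => exact h b hb

theorem APrefers.exists_eq_some {rank : A → B → ℕ} {M M' : A → Option B} {a : A}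
    (h : APrefers rank M M' a) :
    ∃ c, M a = some c ∧ ∀ b, M' a = some b → rank a c < rank a b := by
  unfold APrefers at h
  cases hc : M a with
  | none => simp [hc] at h
  | some c =>
    refine ⟨c, rfl, fun b hb => ?_⟩
    simpa [hc, hb] using h

theorem APrefers.ne {rank : A → B → ℕ} {M M' : A → Option B} {a : A}
    (h : APrefers rank M M' a) : M a ≠ M' a := by
  obtain ⟨c, hc, hlt⟩ := h.exists_eq_some
  intro heq
  exact lt_irrefl _ (hlt c (heq ▸ hc))

theorem IsTopChoice.rank_lt {E : A → B → Prop} {rank : A → B → ℕ} {f : A → B}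
    (hstrict : StrictRanks E rank) (htop : IsTopChoice E rank f) {a : A} {b : B}
    (hb : E a b) (hne : b ≠ f a) : rank a (f a) < rank a b :=
  lt_of_le_of_ne ((htop a).2 b hb) fun h => hne (hstrict a _ _ (htop a).1 hb h).symm

theorem rVal_le {E : A → B → Prop} {rank : A → B → ℕ} {F : Set B} {a : A} {b : B}
    (hb : E a b) (hF : b ∉ F) : rVal E rank F a ≤ rank a b :=
  sInf_le ⟨b, hb, hF, rfl⟩

theorem exists_rank_eq_rVal {E : A → B → Prop} {rank : A → B → ℕ} {F : Set B} {a : A}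
    (h : rVal E rank F a ≠ ⊤) : ∃ b, E a b ∧ b ∉ F ∧ (rank a b : ℕ∞) = rVal E rank F a := by
  have hne : {x : ℕ∞ | ∃ b, E a b ∧ b ∉ F ∧ x = (rank a b : ℕ∞)}.Nonempty := by
    by_contra hempty
    rw [Set.not_nonempty_iff_eq_empty] at hempty
    exact h (by rw [rVal, hempty, sInf_empty])
  obtain ⟨b, hE, hF, hb⟩ := csInf_mem hne
  exact ⟨b, hE, hF, hb.symm⟩

/-- If `M` is popular, every post that some applicant prefers to its own partner is matched to
an applicant whose top choice it is. -/
theorem PopularOne.exists_of_lt [Finite A] {E : A → B → Prop} {rank : A → B → ℕ} {f : A → B}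
    (hstrict : StrictRanks E rank) (htop : IsTopChoice E rank f) {M : A → Option B}
    (hpop : PopularOne E rank M) {a : A} {c : B} (hac : E a c)
    (hlt : ∀ b, M a = some b → rank a c < rank a b) : ∃ a', M a' = some c ∧ f a' = c := by
  obtain ⟨⟨hE, hinj⟩, hbest⟩ := hpop
  by_contra! hno
  by_cases hc : ∃ a', M a' = some c
  · obtain ⟨a', ha'⟩ := hc
    have hfa' : f a' ≠ c := hno a' ha'
    have hne : a ≠ a' := by
      rintro rfl
      exact lt_irrefl _ (hlt c ha')
    set M' : A → Option B := fun x =>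
      if x = a then some c else if x = a' then some (f a') else
        if M x = some (f a') then none else M x with hM'
    have hM'a : M' a = some c := by simp [hM']
    have hM'a' : M' a' = some (f a') := by simp [hM', hne.symm]
    have hmatch : IsMatching E M' := by
      constructor
      · intro x b hx
        have := (htop a').1
        grind
      · intro x y b hx hy
        grind
    have hwin : ({a, a'} : Set A) ⊆ {x | APrefers rank M' M x} := by
      rintro x (rfl | rfl)
      · exact .of_eq_some hM'a hlt
      · refine .of_eq_some hM'a' fun b hb => ?_
        obtain rfl : c = b := Option.some.inj (ha'.symm.trans hb)
        exact htop.rank_lt hstrict (hE _ _ ha') hfa'.symm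
    have hlose : {x | APrefers rank M M' x}.Subsingleton := by
      have key : ∀ x, APrefers rank M M' x → M x = some (f a') := by
        intro x hx
        obtain ⟨d, hd, hxlt⟩ := hx.exists_eq_some
        have hxne := hx.ne
        have hxa : x ≠ a := by
          rintro rfl
          exact lt_asymm (hlt d hd) (hxlt c hM'a)
        have hxa' : x ≠ a' := by
          rintro rfl
          have := hxlt _ hM'a'
          exact this.not_ge ((htop x).2 d (hE _ _ hd))
        by_contra hxf
        exact hxne (by simp [hM', hxa, hxa', hxf])
      exact fun x hx y hy => hinj x y _ (key x hx) (key y hy)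
    have h := hbest M' hmatch
    rw [phiOne_eq_ncard, phiOne_eq_ncard] at h
    have h2 := Set.ncard_le_ncard hwin (Set.toFinite _)
    rw [Set.ncard_pair hne] at h2
    have h1 := Set.ncard_le_one_iff_subsingleton.mpr hlose
    omega
  · set M' : A → Option B := Function.update M a (some c) with hM'
    have hM'a : M' a = some c := by simp [hM']
    have hmatch : IsMatching E M' := by
      constructor
      · intro x b hx
        grind
      · intro x y b hx hy
        grind
    have hlose : {x | APrefers rank M M' x} = ∅ := by
      refine Set.eq_empty_of_forall_notMem fun x hx => ?_
      obtain ⟨d, hd, hxlt⟩ := APrefers.exists_eq_some hx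
      by_cases hxa : x = a
      · subst hxa
        exact lt_asymm (hlt d hd) (hxlt c hM'a)
      · exact hx.ne (by simp [hM', hxa])
    have h := hbest M' hmatch
    rw [phiOne_eq_ncard, phiOne_eq_ncard, hlose, Set.ncard_empty, Nat.le_zero,
      Set.ncard_eq_zero (Set.toFinite _)] at h
    exact Set.eq_empty_iff_forall_notMem.mp h a (.of_eq_some hM'a hlt)

/-- In the 1-sided model, a matching `M` is popular iff
(i) every post `b ∈ F` is matched in `M` to an applicant `a` with `f a = b`, and
(ii) every applicant `a` with `r_a < ∞` is matched to `f a` or to its neighbor of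
rank `r_a`, and every applicant `a` with `r_a = ∞` is matched to `f a` or unmatched. -/
theorem one_sided_popular_characterization
    [Fintype A] [Fintype B]
    (E : A → B → Prop) (rank : A → B → ℕ) (f : A → B)
    (hstrict : StrictRanks E rank) (htop : IsTopChoice E rank f)
    (M : A → Option B) (hM : IsMatching E M) :
    PopularOne E rank M ↔
      ((∀ b ∈ Set.range f, ∃ a, M a = some b ∧ f a = b) ∧
       (∀ a, rVal E rank (Set.range f) a ≠ ⊤ →
          M a = some (f a) ∨
            ∃ b, M a = some b ∧ (rank a b : ℕ∞) = rVal E rank (Set.range f) a) ∧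
       (∀ a, rVal E rank (Set.range f) a = ⊤ →
          M a = some (f a) ∨ M a = none)) := by
  constructor
  · intro hpop
    have hF : ∀ b ∈ Set.range f, ∃ a, M a = some b ∧ f a = b := by
      rintro _ ⟨a, rfl⟩
      by_cases ha : M a = some (f a)
      · exact ⟨a, ha, rfl⟩
      · refine hpop.exists_of_lt hstrict htop (htop a).1 fun b hb => ?_
        exact htop.rank_lt hstrict (hM.1 _ _ hb) fun h => ha (h ▸ hb)
    have hnotF : ∀ a b, M a = some b → M a ≠ some (f a) → b ∉ Set.range f := by
      intro a b hb hne hbF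
      obtain ⟨a', ha', rfl⟩ := hF b hbF
      obtain rfl := hM.2 _ _ _ hb ha'
      exact hne hb
    refine ⟨hF, fun a ha => ?_, fun a ha => ?_⟩
    · by_contra! hcon
      obtain ⟨hne, hr⟩ := hcon
      obtain ⟨c, hac, hcF, hc⟩ := exists_rank_eq_rVal ha
      obtain ⟨a', -, ha'⟩ := hpop.exists_of_lt hstrict htop hac fun b hb => by
        have hle := rVal_le (rank := rank) (hM.1 _ _ hb) (hnotF a b hb hne)
        have hlt := lt_of_le_of_ne hle (hr b hb).symm
        rw [← hc] at hlt
        exact_mod_cast hlt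
      exact hcF ⟨a', ha'⟩
    · by_contra! hcon
      obtain ⟨hne, hsome⟩ := hcon
      obtain ⟨b, hb⟩ := Option.ne_none_iff_exists'.mp hsome
      have hle := rVal_le (rank := rank) (hM.1 _ _ hb) (hnotF a b hb hne)
      rw [ha] at hle
      exact ENat.natCast_ne_top _ (top_le_iff.mp hle)
  · rintro ⟨hF, hfin, htopval⟩
    refine ⟨hM, fun M' hM' => ?_⟩
    have key : ∀ a, APrefers rank M' M a →
        ∃ a', APrefers rank M M' a' ∧ M' a = some (f a') := by
      intro a ha
      obtain ⟨c, hc, hlt⟩ := ha.exists_eq_some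
      have hac := hM'.1 _ _ hc
      have hne : M a ≠ some (f a) := fun h => (hlt _ h).not_ge ((htop a).2 c hac)
      have hcF : c ∈ Set.range f := by
        by_contra hcF
        have hle := rVal_le (rank := rank) hac hcF
        by_cases hr : rVal E rank (Set.range f) a = ⊤
        · rw [hr] at hle
          exact ENat.natCast_ne_top _ (top_le_iff.mp hle)
        · obtain h | ⟨b, hb, hbr⟩ := hfin a hr
          · exact hne h
          · rw [← hbr] at hle
            exact (hlt b hb).not_ge (by exact_mod_cast hle)
      obtain ⟨a', ha', rfl⟩ := hF c hcF
      refine ⟨a', .of_eq_some ha' fun d hd => ?_, hc⟩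
      refine htop.rank_lt hstrict (hM'.1 _ _ hd) fun h => ?_
      subst h
      obtain rfl := hM'.2 _ _ _ hc hd
      exact hne ha'
    choose! g hg hgM using key
    rw [phiOne_eq_ncard, phiOne_eq_ncard]
    refine Set.ncard_le_ncard_of_injOn g hg (fun x hx y hy hxy => ?_) (Set.toFinite _)
    exact hM'.2 _ _ _ (hgM x hx) (hxy ▸ hgM y hy)
end
end
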